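/- arXiv:1405.4980 — 5 statements merged into one kernel-verified Lean document; each statement's English description precedes it below -/
import Mathlib

section
/- Let ‖·‖ be an arbitrary norm on ℝⁿ. Let D ⊆ ℝⁿ be open convex and X ⊆ ℝⁿ be compact convex with X contained in the closure of D and X ∩ D nonempty. Let Φ : D → ℝ be differentiable and ρ-strongly convex w.r.t. ‖·‖ on X ∩ D, i.e. Φ(x) - Φ(y) ≤ ⟪∇Φ(x), x - y⟫ - (ρ/2)‖x - y‖² for all x, y ∈ X ∩ D (ρ > 0). Let f : X → ℝ be convex, L > 0, R > 0 with sup_{x ∈ X∩D} Φ(x) - Φ(x₁) ≤ R², fix t ≥ 1 and set η = (R/L)√(2ρ/t). Suppose x₁ ∈ X ∩ D minimizes Φ over X ∩ D and, for each s ≥ 1: g_s is a subgradient of f at x_s with ‖g_s‖_* ≤ L; y_{s+1} ∈ D satisfies ∇Φ(y_{s+1}) = ∇Φ(x_s) - η g_s; and x_{s+1} ∈ X ∩ D minimizes x ↦ D_Φ(x, y_{s+1}) over X ∩ D, where D_Φ(x, y) = Φ(x) - Φ(y) - ⟪∇Φ(y), x - y⟫. Then for every x ∈ X ∩ D, f((1/t)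 Σ_{s=1}^t x_s) - f(x) ≤ RL√(2/(ρt)). -/
open scoped RealInnerProductSpace

section

variable {E : Type*} [NormedAddCommGroup E] [InnerProductSpace ℝ E]

/-- First-order optimality for a linearly perturbed differentiable function on a convex set. -/
theorem inner_gradient_sub_nonneg_of_isMinOn [CompleteSpace E] {C : Set E} (hC : Convex ℝ C)
    {Φ : E → ℝ} {a p z : E} (hd : DifferentiableAt ℝ Φ p) (hp : p ∈ C) (hz : z ∈ C)
    (hmin : IsMinOn (fun u => Φ u - ⟪a, u⟫) C p) :
    0 ≤ ⟪gradient Φ p - a, z - p⟫ := by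
  have h1 := hd.hasGradientAt.hasFDerivAt.sub ((innerSL ℝ a).hasFDerivAt (x := p))
  have h2 := IsLocalMinOn.hasFDerivWithinAt_nonneg (f := fun u => Φ u - ⟪a, u⟫)
    hmin.localize h1.hasFDerivWithinAt
    (sub_mem_posTangentConeAt_of_segment_subset (hC.segment_subset hp hz))
  simpa [inner_sub_left] using h2

theorem Seminorm.exists_norm_le_mul [FiniteDimensional ℝ E] (N : Seminorm ℝ E)
    (hN : ∀ x, N x = 0 → x = 0) : ∃ C, 0 < C ∧ ∀ x, ‖x‖ ≤ C * N x := by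
  have hcont : Continuous N :=
    continuousOn_univ.mp (N.convexOn.continuousOn isOpen_univ)
  rcases (Metric.sphere (0 : E) 1).eq_empty_or_nonempty with hs | hs
  · refine ⟨1, one_pos, fun x => ?_⟩
    rcases eq_or_ne x 0 with rfl | hx
    · simp
    · have : ‖x‖⁻¹ • x ∈ Metric.sphere (0 : E) 1 := by simp [norm_smul, hx]
      simp [hs] at this
  · obtain ⟨u, hu, hmin⟩ := (isCompact_sphere (0 : E) 1).exists_isMinOn hs hcont.continuousOn
    have hupos : 0 < N u := by
      refine lt_of_le_of_ne (apply_nonneg N u) fun h => ?_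
      simp [hN u h.symm] at hu
    refine ⟨(N u)⁻¹, inv_pos.mpr hupos, fun x => ?_⟩
    rcases eq_or_ne x 0 with rfl | hx
    · simp
    · have hmem : ‖x‖⁻¹ • x ∈ Metric.sphere (0 : E) 1 := by simp [norm_smul, hx]
      have h : N u ≤ N (‖x‖⁻¹ • x) := hmin hmem
      rw [map_smul_eq_mul, norm_inv, norm_norm, inv_mul_eq_div,
        le_div_iff₀ (norm_pos_iff.mpr hx)] at h
      rw [inv_mul_eq_div, le_div_iff₀ hupos]
      linarith

/-- Hölder's inequality for a norm and its dual norm. -/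
theorem Seminorm.inner_le_mul_of_dual_le [FiniteDimensional ℝ E] (N : Seminorm ℝ E)
    (hN : ∀ x, N x = 0 → x = 0) {g : E} {L : ℝ}
    (hg : sSup {d : ℝ | ∃ z : E, N z ≤ 1 ∧ d = ⟪g, z⟫} ≤ L) (v : E) :
    ⟪g, v⟫ ≤ L * N v := by
  obtain ⟨C, hC, hCN⟩ := N.exists_norm_le_mul hN
  have hbdd : BddAbove {d : ℝ | ∃ z : E, N z ≤ 1 ∧ d = ⟪g, z⟫} := by
    refine ⟨‖g‖ * C, ?_⟩
    rintro d ⟨z, hz, rfl⟩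
    refine (real_inner_le_norm g z).trans ?_
    gcongr
    exact (hCN z).trans (mul_le_of_le_one_right hC.le hz)
  rcases eq_or_ne v 0 with rfl | hv
  · simp
  have hNv : 0 < N v := lt_of_le_of_ne (apply_nonneg N v) fun h => hv (hN v h.symm)
  have h : ⟪g, (N v)⁻¹ • v⟫ ≤ L := by
    refine (le_csSup hbdd ⟨_, ?_, rfl⟩).trans hg
    rw [map_smul_eq_mul, norm_inv, Real.norm_of_nonneg hNv.le, inv_mul_cancel₀ hNv.ne']
  rwa [real_inner_smul_right, inv_mul_eq_div, div_le_iff₀ hNv] at h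

/-- One step of mirror descent decreases the Bregman divergence to the comparison point `z`,
up to a quadratic error in the step size. -/
theorem mirror_descent_step (N : Seminorm ℝ E) {Φ : E → ℝ} {Gu Gp Gy g u p z : E} {ρ η L : ℝ}
    (hρ : 0 < ρ) (hη : 0 ≤ η) (hg : ⟪g, u - p⟫ ≤ L * N (u - p))
    (hstrong : Φ u - Φ p ≤ ⟪Gu, u - p⟫ - ρ / 2 * N (u - p) ^ 2)
    (hy : Gy = Gu - η • g) (hopt : 0 ≤ ⟪Gp - Gy, z - p⟫) :
    η * ⟪g, u - z⟫ ≤ (Φ z - Φ u - ⟪Gu, z - u⟫) - (Φ z - Φ p - ⟪Gp, z - p⟫)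
      + η ^ 2 * L ^ 2 / (2 * ρ) := by
  have hyoung : η * (L * N (u - p)) ≤ η ^ 2 * L ^ 2 / (2 * ρ) + ρ / 2 * N (u - p) ^ 2 := by
    have h : η ^ 2 * L ^ 2 / (2 * ρ) + ρ / 2 * N (u - p) ^ 2 - η * (L * N (u - p))
        = (η * L - ρ * N (u - p)) ^ 2 / (2 * ρ) := by
      field_simp
      ring
    have : 0 ≤ (η * L - ρ * N (u - p)) ^ 2 / (2 * ρ) := by positivity
    linarith
  have hgη := mul_le_mul_of_nonneg_left hg hη
  subst hy
  simp only [inner_sub_left, inner_sub_right, real_inner_smul_left] at *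
  linarith

end

/-- Convergence rate of mirror descent. `N` is an arbitrary norm on ℝⁿ, `Φ` is a
ρ-strongly convex (w.r.t. `N`) mirror map on `D`, and the Bregman divergence is
`D_Φ(x,y) = Φ(x) - Φ(y) - ⟪∇Φ(y), x - y⟫`. -/
theorem stmt_15 (n : ℕ) (N : Seminorm ℝ (EuclideanSpace ℝ (Fin n)))
    (hN : ∀ x, N x = 0 → x = 0)
    (D : Set (EuclideanSpace ℝ (Fin n))) (hDopen : IsOpen D) (hDconv : Convex ℝ D)
    (X : Set (EuclideanSpace ℝ (Fin n))) (hXcomp : IsCompact X) (hXconv : Convex ℝ X)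
    (hXD : X ⊆ closure D) (hXDne : (X ∩ D).Nonempty)
    (Φ : EuclideanSpace ℝ (Fin n) → ℝ)
    (hΦdiff : ∀ z ∈ D, DifferentiableAt ℝ Φ z)
    (ρ : ℝ) (hρ : 0 < ρ)
    (hΦstrong : ∀ x ∈ X ∩ D, ∀ y ∈ X ∩ D,
      Φ x - Φ y ≤ ⟪gradient Φ x, x - y⟫ - ρ / 2 * (N (x - y)) ^ 2)
    (f : EuclideanSpace ℝ (Fin n) → ℝ) (hfconv : ConvexOn ℝ X f)
    (L R : ℝ) (hL : 0 < L) (hR : 0 < R)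
    (t : ℕ) (ht : 1 ≤ t)
    (η : ℝ) (hη : η = R / L * Real.sqrt (2 * ρ / t))
    (x y g : ℕ → EuclideanSpace ℝ (Fin n))
    (hx1 : x 1 ∈ X ∩ D) (hx1min : ∀ z ∈ X ∩ D, Φ (x 1) ≤ Φ z)
    (hRbound : ∀ z ∈ X ∩ D, Φ z - Φ (x 1) ≤ R ^ 2)
    (hg : ∀ s ≥ 1, ∀ z ∈ X, f (x s) - f z ≤ ⟪g s, x s - z⟫)
    (hgdual : ∀ s ≥ 1,
      sSup {d : ℝ | ∃ z : EuclideanSpace ℝ (Fin n), N z ≤ 1 ∧ d = ⟪g s, z⟫} ≤ L)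
    (hy : ∀ s ≥ 1, y (s + 1) ∈ D ∧
      gradient Φ (y (s + 1)) = gradient Φ (x s) - η • g s)
    (hx : ∀ s ≥ 1, x (s + 1) ∈ X ∩ D ∧ ∀ z ∈ X ∩ D,
      Φ (x (s + 1)) - Φ (y (s + 1)) - ⟪gradient Φ (y (s + 1)), x (s + 1) - y (s + 1)⟫ ≤
        Φ z - Φ (y (s + 1)) - ⟪gradient Φ (y (s + 1)), z - y (s + 1)⟫)
    (z : EuclideanSpace ℝ (Fin n)) (hz : z ∈ X ∩ D) :
    f ((t : ℝ)⁻¹ • ∑ s ∈ Finset.Icc 1 t, x s) - f z ≤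
      R * L * Real.sqrt (2 / (ρ * t)) := by
  have hC : Convex ℝ (X ∩ D) := hXconv.inter hDconv
  have htpos : (0 : ℝ) < t := by exact_mod_cast ht
  have hηpos : 0 < η := by rw [hη]; positivity
  have hxmem : ∀ s ≥ 1, x s ∈ X ∩ D := by
    intro s hs
    obtain ⟨k, rfl⟩ := Nat.exists_eq_add_of_le' hs
    cases k with
    | zero => exact hx1
    | succ k => exact (hx (k + 1) (by omega)).1
  have hstep : ∀ s ≥ 1, η * (f (x s) - f z) ≤
      (Φ z - Φ (x s) - ⟪gradient Φ (x s), z - x s⟫)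
        - (Φ z - Φ (x (s + 1)) - ⟪gradient Φ (x (s + 1)), z - x (s + 1)⟫)
        + η ^ 2 * L ^ 2 / (2 * ρ) := by
    intro s hs
    obtain ⟨hp, hpmin⟩ := hx s hs
    refine (mul_le_mul_of_nonneg_left (hg s hs z hz.1) hηpos.le).trans ?_
    refine mirror_descent_step N hρ hηpos.le (N.inner_le_mul_of_dual_le hN (hgdual s hs) _)
      (hΦstrong _ (hxmem s hs) _ hp) (hy s hs).2
      (inner_gradient_sub_nonneg_of_isMinOn hC (hΦdiff _ hp.2) hp hz fun w hw => ?_)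
    have := hpmin w hw
    simp only [inner_sub_right] at this
    simp only [Set.mem_ofPred_eq]
    linarith
  have hsum : ∀ k : ℕ, η * ∑ s ∈ Finset.Icc 1 k, (f (x s) - f z) ≤
      (Φ z - Φ (x 1) - ⟪gradient Φ (x 1), z - x 1⟫)
        - (Φ z - Φ (x (k + 1)) - ⟪gradient Φ (x (k + 1)), z - x (k + 1)⟫)
        + k * (η ^ 2 * L ^ 2 / (2 * ρ)) := by
    intro k
    induction k with
    | zero => simp
    | succ k ih =>
      rw [Finset.sum_Icc_succ_top (by omega), mul_add]
      have := hstep (k + 1) (by omega)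
      push_cast
      linarith
  have hfirst : 0 ≤ ⟪gradient Φ (x 1), z - x 1⟫ := by
    simpa using inner_gradient_sub_nonneg_of_isMinOn (a := 0) hC (hΦdiff _ hx1.2) hx1 hz
      fun w hw => by simpa using hx1min w hw
  have hlast : 0 ≤ Φ z - Φ (x (t + 1)) - ⟪gradient Φ (x (t + 1)), z - x (t + 1)⟫ := by
    have h := hΦstrong _ (hxmem (t + 1) (by omega)) z hz
    have : 0 ≤ ρ / 2 * N (x (t + 1) - z) ^ 2 := by positivity
    simp only [inner_sub_right] at *
    linarith
  have hjensen : f ((t : ℝ)⁻¹ • ∑ s ∈ Finset.Icc 1 t, x s) ≤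
      (t : ℝ)⁻¹ * ∑ s ∈ Finset.Icc 1 t, f (x s) := by
    have h := hfconv.map_sum_le (t := Finset.Icc 1 t) (w := fun _ => (t : ℝ)⁻¹) (p := x)
      (fun _ _ => by positivity) (by simp [htpos.ne'])
      (fun s hs => (hxmem s (Finset.mem_Icc.mp hs).1).1)
    simpa only [← Finset.smul_sum, smul_eq_mul, ← Finset.mul_sum] using h
  have htotal : η * ∑ s ∈ Finset.Icc 1 t, (f (x s) - f z) ≤
      R ^ 2 + t * (η ^ 2 * L ^ 2 / (2 * ρ)) := by
    linarith [hsum t, hRbound z hz]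
  have hsumsub : ∑ s ∈ Finset.Icc 1 t, (f (x s) - f z) =
      ∑ s ∈ Finset.Icc 1 t, f (x s) - t * f z := by simp
  have hηsq : t * (η ^ 2 * L ^ 2 / (2 * ρ)) = R ^ 2 := by
    rw [hη, mul_pow, Real.sq_sqrt (by positivity)]
    field_simp
  have hrate : η * (t * (R * L * Real.sqrt (2 / (ρ * t)))) = 2 * R ^ 2 := by
    have hsqrt : Real.sqrt (2 * ρ / t) * Real.sqrt (2 / (ρ * t)) = 2 / t := by
      rw [← Real.sqrt_mul (by positivity), show 2 * ρ / t * (2 / (ρ * t)) = (2 / (t : ℝ)) ^ 2 by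
        field_simp, Real.sqrt_sq (by positivity)]
    calc η * (t * (R * L * Real.sqrt (2 / (ρ * t))))
        = R / L * t * (R * L) * (Real.sqrt (2 * ρ / t) * Real.sqrt (2 / (ρ * t))) := by
          rw [hη]; ring
      _ = 2 * R ^ 2 := by
          rw [hsqrt]
          field_simp
  have hle : ∑ s ∈ Finset.Icc 1 t, f (x s) - t * f z ≤
      t * (R * L * Real.sqrt (2 / (ρ * t))) := by
    refine le_of_mul_le_mul_left ?_ hηpos
    rw [← hsumsub, hrate]
    linarith
  calc f ((t : ℝ)⁻¹ • ∑ s ∈ Finset.Icc 1 t, x s) - f z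
      ≤ (t : ℝ)⁻¹ * (∑ s ∈ Finset.Icc 1 t, f (x s) - t * f z) := by
        rw [mul_sub, inv_mul_cancel_left₀ htpos.ne']
        linarith
    _ ≤ R * L * Real.sqrt (2 / (ρ * t)) := by
        rwa [inv_mul_le_iff₀ htpos]
end

section
/- Let a ∈ ℝⁿ, ε ∈ (0,1) and g ≥ 0 with ‖a‖₂ ≥ g. Then there exists c ∈ ℝⁿ such that for every δ ≥ 0, {x ∈ ℝⁿ : ‖x‖₂² ≤ 1 - εg² - δ} ∩ {x ∈ ℝⁿ : ‖x - a‖₂² ≤ g²(1 - ε) - δ} ⊆ {x ∈ ℝⁿ : ‖x - c‖₂² ≤ 1 - √ε - δ}. -/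
/-- The geometric lemma behind geometric descent: the intersection of the two shrunk
balls is contained in a ball of squared radius `1 - √ε - δ`. -/
theorem stmt_16 (n : ℕ) (a : EuclideanSpace ℝ (Fin n)) (ε g : ℝ)
    (hε : 0 < ε) (hε1 : ε < 1) (hg : 0 ≤ g) (hag : g ≤ ‖a‖) :
    ∃ c : EuclideanSpace ℝ (Fin n), ∀ δ : ℝ, 0 ≤ δ →
      {x : EuclideanSpace ℝ (Fin n) | ‖x‖ ^ 2 ≤ 1 - ε * g ^ 2 - δ} ∩
        {x : EuclideanSpace ℝ (Fin n) | ‖x - a‖ ^ 2 ≤ g ^ 2 * (1 - ε) - δ} ⊆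
        {x : EuclideanSpace ℝ (Fin n) | ‖x - c‖ ^ 2 ≤ 1 - Real.sqrt ε - δ} := by
  have ht0 : 0 ≤ √ε := Real.sqrt_nonneg ε
  have ht1 : √ε ≤ 1 := Real.sqrt_le_one.mpr hε1.le
  have ht2 : √ε ^ 2 = ε := Real.sq_sqrt hε.le
  have hga : g ^ 2 ≤ ‖a‖ ^ 2 := pow_le_pow_left₀ hg hag 2
  refine ⟨√ε • a, ?_⟩
  rintro δ - x ⟨hx, hxa⟩
  simp only [Set.mem_ofPred_eq] at hx hxa ⊢
  generalize √ε = t at *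
  subst ht2
  have stewart : ‖x - t • a‖ ^ 2 =
      (1 - t) * ‖x‖ ^ 2 + t * ‖x - a‖ ^ 2 - t * (1 - t) * ‖a‖ ^ 2 := by
    rw [norm_sub_sq_real, norm_sub_sq_real, real_inner_smul_right, norm_smul, mul_pow,
      Real.norm_eq_abs, sq_abs]
    ring
  have h₁ := mul_le_mul_of_nonneg_left hx (sub_nonneg.mpr ht1)
  have h₂ := mul_le_mul_of_nonneg_left hxa ht0
  have h₃ := mul_le_mul_of_nonneg_left hga (mul_nonneg ht0 (sub_nonneg.mpr ht1))
  rw [stewart]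
  linarith
end

section
/- Let f : ℝⁿ → ℝ be differentiable, α-strongly convex and β-smooth with 0 < α ≤ β, let x* be the global minimizer of f, and set κ = β/α. Starting from x₁ = y₁ ∈ ℝⁿ, define for t ≥ 1 the Nesterov accelerated gradient descent iterates: y_{t+1} = x_t - (1/β)∇f(x_t) and x_{t+1} = (1 + (√κ - 1)/(√κ + 1)) y_{t+1} - ((√κ - 1)/(√κ + 1)) y_t. Then for every t ≥ 1, f(y_t) - f(x*) ≤ ((α + β)/2) · ‖x₁ - x*‖₂² · exp(-(t - 1)/√κ). -/
open scoped RealInnerProductSpace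

section Helpers

variable {E : Type*} [NormedAddCommGroup E] [InnerProductSpace ℝ E] [CompleteSpace E]

/-- The quadratic upper bound satisfied by a function with Lipschitz gradient. -/
theorem le_add_inner_gradient_add_of_lipschitz_gradient {f : E → ℝ} {β : ℝ}
    (hdiff : Differentiable ℝ f)
    (hsmooth : ∀ x y, ‖gradient f x - gradient f y‖ ≤ β * ‖x - y‖) (x d : E) :
    f (x + d) ≤ f x + ⟪gradient f x, d⟫ + β / 2 * ‖d‖ ^ 2 := by
  let φ : ℝ → ℝ := fun s => f (x + s • d) - s * ⟪gradient f x, d⟫ - β / 2 * s ^ 2 * ‖d‖ ^ 2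
  have hφ (s : ℝ) : HasDerivAt φ
      (⟪gradient f (x + s • d) - gradient f x, d⟫ - β * s * ‖d‖ ^ 2) s := by
    have hline : HasDerivAt (fun s : ℝ => x + s • d) d s := by
      simpa using ((hasDerivAt_id s).smul_const d).const_add x
    have hf : HasDerivAt (fun s : ℝ => f (x + s • d)) ⟪gradient f (x + s • d), d⟫ s := by
      simpa [Function.comp_def] using
        ((hdiff (x + s • d)).hasGradientAt.hasFDerivAt.comp_hasDerivAt s hline)
    have hlin := (hasDerivAt_id s).mul_const ⟪gradient f x, d⟫
    have hquad := (((hasDerivAt_id s).pow 2).const_mul (β / 2)).mul_const (‖d‖ ^ 2)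
    refine ((hf.sub hlin).sub hquad).congr_deriv ?_
    simp only [inner_sub_left, id]
    push_cast
    ring
  have hanti : AntitoneOn φ (Set.Icc 0 1) := by
    refine antitoneOn_of_deriv_nonpos (convex_Icc 0 1)
      (fun s _ => (hφ s).continuousAt.continuousWithinAt)
      (fun s _ => (hφ s).differentiableAt.differentiableWithinAt) fun s hs => ?_
    rw [interior_Icc] at hs
    rw [(hφ s).deriv]
    have hlip := hsmooth (x + s • d) x
    rw [add_sub_cancel_left, norm_smul, Real.norm_of_nonneg hs.1.le] at hlip
    have hinner := real_inner_le_norm (gradient f (x + s • d) - gradient f x) d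
    nlinarith [mul_le_mul_of_nonneg_right hlip (norm_nonneg d)]
  have h := hanti (Set.left_mem_Icc.2 zero_le_one) (Set.right_mem_Icc.2 zero_le_one) zero_le_one
  simp only [φ, one_smul, zero_smul, add_zero] at h
  linarith

/-- One step of Nesterov's scheme contracts the Lyapunov function
`f y - f p + α / 2 * ‖v - p‖ ^ 2`, where `v = (1 + q) x - q y`, by the factor `1 - 1 / q`. -/
theorem nesterov_lyapunov_step {f : E → ℝ} {α β q : ℝ} (hα : 0 < α) (hq : 1 ≤ q)
    (hβ : β = α * q ^ 2) (hdiff : Differentiable ℝ f)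
    (hsmooth : ∀ x y, ‖gradient f x - gradient f y‖ ≤ β * ‖x - y‖)
    (hstrong : ∀ x y, f x - f y ≤ ⟪gradient f x, x - y⟫ - α / 2 * ‖x - y‖ ^ 2)
    {p x y x' y' : E} (hy : y' = x - (1 / β) • gradient f x)
    (hx : x' = (1 + (q - 1) / (q + 1)) • y' - ((q - 1) / (q + 1)) • y) :
    f y' - f p + α / 2 * ‖(1 + q) • x' - q • y' - p‖ ^ 2 ≤
      (1 - 1 / q) * (f y - f p + α / 2 * ‖(1 + q) • x - q • y - p‖ ^ 2) := by
  have hq0 : 0 < q := by linarith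
  have hq1 : q + 1 ≠ 0 := by linarith
  have hβ0 : 0 < β := by rw [hβ]; positivity
  set g := gradient f x with hg
  have hdesc : f y' ≤ f x - 1 / (2 * β) * ‖g‖ ^ 2 := by
    have h := le_add_inner_gradient_add_of_lipschitz_gradient hdiff hsmooth x (-((1 / β) • g))
    rw [← sub_eq_add_neg, ← hy, ← hg, inner_neg_right, real_inner_smul_right,
      real_inner_self_eq_norm_sq, norm_neg, norm_smul, mul_pow, Real.norm_eq_abs, sq_abs] at h
    refine h.trans (le_of_eq ?_)
    field_simp
    ring
  obtain ⟨a, rfl⟩ : ∃ a, x = p + a := ⟨x - p, by abel⟩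
  obtain ⟨b, rfl⟩ : ∃ b, y = p + a - b := ⟨p + a - y, by abel⟩
  have hv : (1 + q) • (p + a) - q • (p + a - b) - p = a + q • b := by module
  have hv' : (1 + q) • x' - q • y' - p = a + (q - 1) • b - (1 / (α * q)) • g := by
    rw [hx, hy, hβ]
    match_scalars <;> field_simp <;> ring
  have h₁ := hstrong (p + a) (p + a - b)
  have h₂ := hstrong (p + a) p
  rw [sub_sub_cancel, ← hg] at h₁
  rw [add_sub_cancel_left, ← hg] at h₂
  rw [hv, hv']
  have hθ : 0 ≤ 1 - 1 / q := by rw [sub_nonneg, div_le_one hq0]; exact hq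
  have e₁ : ‖a + q • b‖ ^ 2 = ‖a‖ ^ 2 + 2 * q * ⟪a, b⟫ + q ^ 2 * ‖b‖ ^ 2 := by
    rw [norm_add_sq_real, real_inner_smul_right, norm_smul, mul_pow, Real.norm_eq_abs, sq_abs]
    ring
  have e₂ : ‖a + (q - 1) • b - (1 / (α * q)) • g‖ ^ 2 =
      ‖a‖ ^ 2 + 2 * (q - 1) * ⟪a, b⟫ + (q - 1) ^ 2 * ‖b‖ ^ 2
        - 2 / (α * q) * (⟪g, a⟫ + (q - 1) * ⟪g, b⟫) + 1 / (α * q) ^ 2 * ‖g‖ ^ 2 := by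
    rw [norm_sub_sq_real, norm_add_sq_real]
    simp only [inner_add_left, real_inner_smul_right, norm_smul, mul_pow,
      Real.norm_eq_abs, sq_abs, real_inner_comm g]
    ring
  have hconv := add_le_add (mul_le_mul_of_nonneg_left h₁ hθ)
    (mul_le_mul_of_nonneg_left h₂ (by positivity : 0 ≤ 1 / q))
  have hdrop : 0 ≤ α / 2 * (1 - 1 / q) * (q * ‖b‖ ^ 2) +
      α / 2 * (1 - 1 / q) * ‖b‖ ^ 2 := by positivity
  rw [e₁, e₂]
  rw [hβ] at hdesc
  have key : (1 - 1 / q) * (f (p + a - b) - f p +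
        α / 2 * (‖a‖ ^ 2 + 2 * q * ⟪a, b⟫ + q ^ 2 * ‖b‖ ^ 2)) -
      (f (p + a) - 1 / (2 * (α * q ^ 2)) * ‖g‖ ^ 2 - f p +
        α / 2 * (‖a‖ ^ 2 + 2 * (q - 1) * ⟪a, b⟫ + (q - 1) ^ 2 * ‖b‖ ^ 2
          - 2 / (α * q) * (⟪g, a⟫ + (q - 1) * ⟪g, b⟫) + 1 / (α * q) ^ 2 * ‖g‖ ^ 2)) =
      ((1 - 1 / q) * (⟪g, b⟫ - α / 2 * ‖b‖ ^ 2) + 1 / q * (⟪g, a⟫ - α / 2 * ‖a‖ ^ 2)) -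
      ((1 - 1 / q) * (f (p + a) - f (p + a - b)) + 1 / q * (f (p + a) - f p)) +
      (α / 2 * (1 - 1 / q) * (q * ‖b‖ ^ 2) + α / 2 * (1 - 1 / q) * ‖b‖ ^ 2) := by
    field_simp
    ring
  linarith

end Helpers

/-- Convergence rate of Nesterov's accelerated gradient descent for smooth strongly
convex functions. -/
theorem stmt_17 (n : ℕ) (f : EuclideanSpace ℝ (Fin n) → ℝ)
    (hdiff : Differentiable ℝ f)
    (α β : ℝ) (hα : 0 < α) (hαβ : α ≤ β)
    (hsmooth : ∀ x y : EuclideanSpace ℝ (Fin n),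
      ‖gradient f x - gradient f y‖ ≤ β * ‖x - y‖)
    (hstrong : ∀ x y : EuclideanSpace ℝ (Fin n),
      f x - f y ≤ ⟪gradient f x, x - y⟫ - α / 2 * ‖x - y‖ ^ 2)
    (xstar : EuclideanSpace ℝ (Fin n)) (hmin : ∀ y, f xstar ≤ f y)
    (κ : ℝ) (hκ : κ = β / α)
    (x y : ℕ → EuclideanSpace ℝ (Fin n))
    (hinit : x 1 = y 1)
    (hy : ∀ s ≥ 1, y (s + 1) = x s - (1 / β) • gradient f (x s))
    (hx : ∀ s ≥ 1, x (s + 1) =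
      (1 + (Real.sqrt κ - 1) / (Real.sqrt κ + 1)) • y (s + 1) -
        ((Real.sqrt κ - 1) / (Real.sqrt κ + 1)) • y s)
    (t : ℕ) (ht : 1 ≤ t) :
    f (y t) - f xstar ≤
      (α + β) / 2 * ‖x 1 - xstar‖ ^ 2 * Real.exp (-((t : ℝ) - 1) / Real.sqrt κ) := by
  have hκ1 : 1 ≤ κ := by rw [hκ, one_le_div hα]; exact hαβ
  set q := Real.sqrt κ
  have hq : 1 ≤ q := Real.one_le_sqrt.2 hκ1
  have hβ : β = α * q ^ 2 := by
    rw [Real.sq_sqrt (by linarith), hκ]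
    field_simp
  have hgrad : gradient f xstar = 0 := by
    have hloc : IsLocalMin f xstar := Filter.Eventually.of_forall hmin
    simp [gradient, hloc.fderiv_eq_zero]
  suffices hV : f (y t) - f xstar + α / 2 * ‖(1 + q) • x t - q • y t - xstar‖ ^ 2 ≤
      (α + β) / 2 * ‖x 1 - xstar‖ ^ 2 * Real.exp (-((t : ℝ) - 1) / q) by
    have : 0 ≤ α / 2 * ‖(1 + q) • x t - q • y t - xstar‖ ^ 2 := by positivity
    linarith
  induction t, ht using Nat.le_induction with
  | base =>
    have h := le_add_inner_gradient_add_of_lipschitz_gradient hdiff hsmooth xstar (x 1 - xstar)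
    rw [hgrad, inner_zero_left, add_sub_cancel] at h
    have hv : (1 + q) • x 1 - q • x 1 - xstar = x 1 - xstar := by module
    rw [← hinit, hv]
    simp only [Nat.cast_one, sub_self, neg_zero, zero_div, Real.exp_zero]
    linarith
  | succ s hs ih =>
    have hθ : 0 ≤ 1 - 1 / q := by rw [sub_nonneg, div_le_one (by linarith)]; exact hq
    have hexp : 1 - 1 / q ≤ Real.exp (-(1 / q)) := Real.one_sub_le_exp_neg _
    calc _ ≤ (1 - 1 / q) * _ :=
          nesterov_lyapunov_step hα hq hβ hdiff hsmooth hstrong (hy s hs) (hx s hs)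
      _ ≤ (1 - 1 / q) *
          ((α + β) / 2 * ‖x 1 - xstar‖ ^ 2 * Real.exp (-((s : ℝ) - 1) / q)) := by gcongr
      _ ≤ Real.exp (-(1 / q)) *
          ((α + β) / 2 * ‖x 1 - xstar‖ ^ 2 * Real.exp (-((s : ℝ) - 1) / q)) := by
        have : 0 < β := by linarith
        gcongr
      _ = _ := by
        rw [mul_left_comm, ← Real.exp_add]
        push_cast
        ring_nf
end

section
/- Let f : ℝⁿ → ℝ be convex, differentiable and β-smooth (β > 0), with a global minimizer x*. Define λ₀ = 0, λ_t = (1 + √(1 + 4λ_{t-1}²))/2 for t ≥ 1, and γ_t = (1 - λ_t)/λ_{t+1}. Starting from x₁ = y₁ ∈ ℝⁿ, define for t ≥ 1 the iterates y_{t+1} = x_t - (1/β)∇f(x_t) and x_{t+1} = (1 - γ_t) y_{t+1} + γ_t y_t. Then for every t ≥ 1, f(y_t) - f(x*) ≤ 2β‖x₁ - x*‖₂² / t². -/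
open scoped RealInnerProductSpace

section FirstOrderBounds

variable {E : Type*} [NormedAddCommGroup E] [InnerProductSpace ℝ E] [CompleteSpace E]
  {f : E → ℝ}

theorem Differentiable.hasDerivAt_comp_add_smul (hf : Differentiable ℝ f) (x v : E) (t : ℝ) :
    HasDerivAt (fun s : ℝ => f (x + s • v)) ⟪gradient f (x + t • v), v⟫ t := by
  have hline : HasDerivAt (fun s : ℝ => x + s • v) v t := by
    simpa using ((hasDerivAt_id t).smul_const v).const_add x
  exact (hf (x + t • v)).hasGradientAt.hasFDerivAt.comp_hasDerivAt t hline

/-- The first-order lower bound for a differentiable convex function. -/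
theorem ConvexOn.add_inner_gradient_le (hconv : ConvexOn ℝ Set.univ f)
    (hf : Differentiable ℝ f) (x z : E) : f x + ⟪gradient f x, z - x⟫ ≤ f z := by
  have hc : ConvexOn ℝ Set.univ (fun s : ℝ => f (x + s • (z - x))) := by
    refine ⟨convex_univ, fun a _ b _ p q hp hq hpq => ?_⟩
    convert hconv.2 (Set.mem_univ (x + a • (z - x))) (Set.mem_univ (x + b • (z - x)))
      hp hq hpq using 2
    have hx : x = (p + q) • x := by rw [hpq, one_smul]
    nth_rewrite 1 [hx]
    simp only [smul_eq_mul]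
    module
  have h := hc.le_slope_of_hasDerivAt (Set.mem_univ 0) (Set.mem_univ 1) zero_lt_one
    (hf.hasDerivAt_comp_add_smul x (z - x) 0)
  simp only [slope_def_field, zero_smul, one_smul, add_zero, add_sub_cancel, sub_zero,
    div_one] at h
  linarith

/-- The descent lemma: the quadratic upper bound for a function with Lipschitz gradient. -/
theorem Differentiable.le_add_inner_gradient_add_sq (hf : Differentiable ℝ f) {β : ℝ}
    (hsmooth : ∀ x y, ‖gradient f x - gradient f y‖ ≤ β * ‖x - y‖) (x v : E) :
    f (x + v) ≤ f x + ⟪gradient f x, v⟫ + β / 2 * ‖v‖ ^ 2 := by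
  let φ : ℝ → ℝ := fun t => f (x + t • v) - t * ⟪gradient f x, v⟫ - β / 2 * ‖v‖ ^ 2 * t ^ 2
  have hφ (t : ℝ) : HasDerivAt φ
      (⟪gradient f (x + t • v), v⟫ - ⟪gradient f x, v⟫ - β * ‖v‖ ^ 2 * t) t := by
    refine HasDerivAt.congr_deriv (((hf.hasDerivAt_comp_add_smul x v t).sub
      ((hasDerivAt_id t).mul_const ⟪gradient f x, v⟫)).sub
      ((hasDerivAt_pow 2 t).const_mul (β / 2 * ‖v‖ ^ 2))) ?_
    push_cast
    ring
  have hanti : AntitoneOn φ (Set.Icc 0 1) := by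
    refine antitoneOn_of_deriv_nonpos (convex_Icc 0 1)
      (fun t _ => (hφ t).continuousAt.continuousWithinAt)
      (fun t _ => (hφ t).differentiableAt.differentiableWithinAt) fun t ht => ?_
    rw [interior_Icc] at ht
    rw [(hφ t).deriv, ← inner_sub_left]
    have hlip := hsmooth (x + t • v) x
    rw [add_sub_cancel_left, norm_smul, Real.norm_of_nonneg ht.1.le] at hlip
    have hcs := real_inner_le_norm (gradient f (x + t • v) - gradient f x) v
    nlinarith [mul_le_mul_of_nonneg_right hlip (norm_nonneg v)]
  have h := hanti (Set.left_mem_Icc.2 zero_le_one) (Set.right_mem_Icc.2 zero_le_one) zero_le_one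
  simp only [φ, zero_smul, one_smul, add_zero, zero_mul, one_mul, sub_zero, one_pow, mul_one,
    zero_pow two_ne_zero, mul_zero] at h
  linarith

/-- The progress of one gradient step, measured against an arbitrary point. -/
theorem ConvexOn.gradient_step_sub_le (hconv : ConvexOn ℝ Set.univ f)
    (hf : Differentiable ℝ f) {β : ℝ} (hβ : 0 < β)
    (hsmooth : ∀ x y, ‖gradient f x - gradient f y‖ ≤ β * ‖x - y‖) (x z : E) :
    f (x - (1 / β) • gradient f x) - f z ≤
      ⟪gradient f x, x - z⟫ - 1 / (2 * β) * ‖gradient f x‖ ^ 2 := by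
  have hdesc := hf.le_add_inner_gradient_add_sq hsmooth x (-((1 / β) • gradient f x))
  have hlow := hconv.add_inner_gradient_le hf x z
  rw [← sub_eq_add_neg, inner_neg_right, real_inner_smul_right, real_inner_self_eq_norm_sq,
    norm_neg, norm_smul, mul_pow, Real.norm_eq_abs, sq_abs] at hdesc
  rw [← neg_sub x z, inner_neg_right] at hlow
  have hcoef : β / 2 * ((1 / β) ^ 2 * ‖gradient f x‖ ^ 2) - 1 / β * ‖gradient f x‖ ^ 2 =
      -(1 / (2 * β) * ‖gradient f x‖ ^ 2) := by
    field_simp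
    ring
  linarith

/-- The potential of the accelerated method does not increase along one step. -/
theorem ConvexOn.nesterov_potential_step (hconv : ConvexOn ℝ Set.univ f)
    (hf : Differentiable ℝ f) {β : ℝ} (hβ : 0 < β)
    (hsmooth : ∀ x y, ‖gradient f x - gradient f y‖ ≤ β * ‖x - y‖) (x y z : E)
    {l : ℝ} (hl : 1 ≤ l) :
    l ^ 2 * (f (x - (1 / β) • gradient f x) - f z) +
        β / 2 * ‖l • x - (l - 1) • y - z - (l / β) • gradient f x‖ ^ 2 ≤
      (l ^ 2 - l) * (f y - f z) + β / 2 * ‖l • x - (l - 1) • y - z‖ ^ 2 := by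
  have hstep := hconv.gradient_step_sub_le hf hβ hsmooth x
  have hstep_y := mul_le_mul_of_nonneg_left (hstep y)
    (mul_nonneg (zero_le_one.trans hl) (sub_nonneg.2 hl))
  have hstep_z := mul_le_mul_of_nonneg_left (hstep z) (zero_le_one.trans hl)
  have hinner : ⟪gradient f x, l • x - (l - 1) • y - z⟫ =
      (l - 1) * ⟪gradient f x, x - y⟫ + ⟪gradient f x, x - z⟫ := by
    simp only [inner_sub_right, real_inner_smul_right]
    ring
  rw [norm_sub_sq_real, real_inner_smul_right, real_inner_comm, hinner, norm_smul, mul_pow,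
    Real.norm_eq_abs, sq_abs]
  have hcoef (a b : ℝ) : β / 2 * (a - 2 * (l / β * b) + (l / β) ^ 2 * ‖gradient f x‖ ^ 2) =
      β / 2 * a - l * b + l ^ 2 * (1 / (2 * β) * ‖gradient f x‖ ^ 2) := by
    field_simp
  rw [hcoef]
  linarith

end FirstOrderBounds

section StepWeights

variable {lam : ℕ → ℝ}

theorem nesterov_weight_sq_sub
    (hlam : ∀ s : ℕ, lam (s + 1) = (1 + Real.sqrt (1 + 4 * lam s ^ 2)) / 2) (s : ℕ) :
    lam (s + 1) ^ 2 - lam (s + 1) = lam s ^ 2 := by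
  have hsq := Real.sq_sqrt (show 0 ≤ 1 + 4 * lam s ^ 2 by positivity)
  rw [hlam]
  linarith

theorem nesterov_weight_lower_bound (hlam0 : lam 0 = 0)
    (hlam : ∀ s : ℕ, lam (s + 1) = (1 + Real.sqrt (1 + 4 * lam s ^ 2)) / 2) (s : ℕ) :
    (s + 2 : ℝ) / 2 ≤ lam (s + 1) := by
  induction s with
  | zero => norm_num [hlam, hlam0]
  | succ s ih =>
    rw [hlam (s + 1)]
    have h : 2 * lam (s + 1) ≤ Real.sqrt (1 + 4 * lam (s + 1) ^ 2) :=
      Real.le_sqrt_of_sq_le (by linarith)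
    push_cast
    linarith

end StepWeights

/-- Convergence rate of Nesterov's accelerated gradient descent for smooth convex
functions. -/
theorem stmt_18 (n : ℕ) (f : EuclideanSpace ℝ (Fin n) → ℝ)
    (hconv : ConvexOn ℝ Set.univ f) (hdiff : Differentiable ℝ f)
    (β : ℝ) (hβ : 0 < β)
    (hsmooth : ∀ x y : EuclideanSpace ℝ (Fin n),
      ‖gradient f x - gradient f y‖ ≤ β * ‖x - y‖)
    (xstar : EuclideanSpace ℝ (Fin n)) (hmin : ∀ y, f xstar ≤ f y)
    (lam γ : ℕ → ℝ)
    (hlam0 : lam 0 = 0)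
    (hlam : ∀ s : ℕ, lam (s + 1) = (1 + Real.sqrt (1 + 4 * lam s ^ 2)) / 2)
    (hγ : ∀ s : ℕ, γ s = (1 - lam s) / lam (s + 1))
    (x y : ℕ → EuclideanSpace ℝ (Fin n))
    (hinit : x 1 = y 1)
    (hy : ∀ s ≥ 1, y (s + 1) = x s - (1 / β) • gradient f (x s))
    (hx : ∀ s ≥ 1, x (s + 1) = (1 - γ s) • y (s + 1) + γ s • y s)
    (t : ℕ) (ht : 1 ≤ t) :
    f (y t) - f xstar ≤ 2 * β * ‖x 1 - xstar‖ ^ 2 / (t : ℝ) ^ 2 := by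
  have hone (s : ℕ) : 1 ≤ lam (s + 1) := by
    have := nesterov_weight_lower_bound hlam0 hlam s
    have : (0 : ℝ) ≤ s := s.cast_nonneg
    linarith
  have hpotential (s : ℕ) : lam s ^ 2 * (f (y (s + 1)) - f xstar) +
      β / 2 * ‖lam (s + 1) • x (s + 1) - (lam (s + 1) - 1) • y (s + 1) - xstar‖ ^ 2 ≤
      β / 2 * ‖x 1 - xstar‖ ^ 2 := by
    induction s with
    | zero => simp [hlam, hlam0]
    | succ s ih =>
      have hstep := hconv.nesterov_potential_step hdiff hβ hsmooth
        (x (s + 1)) (y (s + 1)) xstar (hone s)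
      rw [nesterov_weight_sq_sub hlam, ← hy (s + 1) (by lia)] at hstep
      have hmomentum : lam (s + 2) • x (s + 2) - (lam (s + 2) - 1) • y (s + 2) - xstar =
          lam (s + 1) • x (s + 1) - (lam (s + 1) - 1) • y (s + 1) - xstar -
            (lam (s + 1) / β) • gradient f (x (s + 1)) := by
        have hγ' : lam (s + 2) * γ (s + 1) = 1 - lam (s + 1) := by
          rw [hγ, mul_div_cancel₀ _ (zero_lt_one.trans_le (hone (s + 1))).ne']
        have hsplit : lam (s + 2) • x (s + 2) = lam (s + 2) • y (s + 2) +
            (lam (s + 2) * γ (s + 1)) • (y (s + 1) - y (s + 2)) := by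
          rw [hx (s + 1) (by lia)]
          module
        rw [hsplit, hγ', hy (s + 1) (by lia)]
        module
      rw [hmomentum]
      exact hstep.trans ih
  have hD : 0 ≤ β * ‖x 1 - xstar‖ ^ 2 := by positivity
  obtain ⟨s, rfl⟩ := Nat.exists_eq_add_of_le' ht
  rcases s with _ | s
  · have hgrad : gradient f xstar = 0 := by
      have hlocal : IsLocalMin f xstar := Filter.Eventually.of_forall hmin
      simp [gradient, hlocal.fderiv_eq_zero]
    have h := hdiff.le_add_inner_gradient_add_sq hsmooth xstar (x 1 - xstar)
    rw [add_sub_cancel, hgrad, inner_zero_left] at h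
    norm_num [← hinit]
    linarith
  · have hlow := nesterov_weight_lower_bound hlam0 hlam s
    have hbound : ((s + 2 : ℝ) / 2) ^ 2 * (f (y (s + 2)) - f xstar) ≤
        β / 2 * ‖x 1 - xstar‖ ^ 2 :=
      (mul_le_mul_of_nonneg_right (pow_le_pow_left₀ (by positivity) hlow 2)
        (sub_nonneg.2 (hmin _))).trans
        ((le_add_of_nonneg_right (by positivity)).trans (hpotential (s + 1)))
    rw [le_div_iff₀ (by positivity)]
    push_cast
    linarith
end

section
/- Let f : ℝⁿ → ℝ be twice differentiable with M-Lipschitz Hessian for some M > 0, i.e. ‖∇²f(x) - ∇²f(y)‖ ≤ M‖x - y‖₂ in operator norm for all x, y. Let x* ∈ ℝⁿ satisfy ∇f(x*) = 0 and ∇²f(x*) ⪰ μ·Iₙ for some μ > 0. Suppose x₀ ∈ ℝⁿ satisfies ‖x₀ - x*‖₂ ≤ μ/(2M), and that the sequence (x_k) satisfies x_{k+1} = x_k - [∇²f(x_k)]⁻¹ ∇f(x_k) whenever ∇²f(x_k) is invertible. Then for every k ≥ 0: ∇²f(x_k) is invertible (so the Newton iteration is well defined), ‖x_k - x*‖₂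 ≤ μ/(2M), and ‖x_{k+1} - x*‖₂ ≤ (M/μ)‖x_k - x*‖₂². -/
open scoped RealInnerProductSpace

/-- Second-order Taylor bound for a map whose derivative is Lipschitz. -/
theorem norm_sub_sub_fderiv_le_of_lipschitz {E F : Type*}
    [NormedAddCommGroup E] [NormedSpace ℝ E] [NormedAddCommGroup F] [NormedSpace ℝ F]
    {g : E → F} (hg : Differentiable ℝ g) {M : ℝ}
    (hLip : ∀ x y : E, ‖fderiv ℝ g x - fderiv ℝ g y‖ ≤ M * ‖x - y‖) (x y : E) :
    ‖g y - g x - fderiv ℝ g x (y - x)‖ ≤ M / 2 * ‖y - x‖ ^ 2 := by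
  set v := y - x with hv
  have hderiv : ∀ t : ℝ, HasDerivAt (fun t : ℝ => g (x + t • v) - g x - t • fderiv ℝ g x v)
      ((fderiv ℝ g (x + t • v) - fderiv ℝ g x) v) t := by
    intro t
    have hline : HasDerivAt (fun t : ℝ => x + t • v) v t := by
      simpa using ((hasDerivAt_id t).smul_const v).const_add x
    have hlin : HasDerivAt (fun t : ℝ => t • fderiv ℝ g x v) (fderiv ℝ g x v) t := by
      simpa using (hasDerivAt_id t).smul_const (fderiv ℝ g x v)
    exact (((hg _).hasFDerivAt.comp_hasDerivAt t hline).sub_const (g x)).sub hlin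
  have hbound : ∀ t : ℝ, HasDerivAt (fun t : ℝ => M / 2 * ‖v‖ ^ 2 * t ^ 2)
      (M * ‖v‖ ^ 2 * t) t := by
    intro t
    refine ((hasDerivAt_pow 2 t).const_mul (M / 2 * ‖v‖ ^ 2)).congr_deriv ?_
    norm_num
    ring
  have key := image_norm_le_of_norm_deriv_right_le_deriv_boundary
    (a := 0) (b := 1) (fun t _ => (hderiv t).continuousAt.continuousWithinAt)
    (fun t _ => (hderiv t).hasDerivWithinAt) (by simp) hbound
    (fun t ht => by
      refine (ContinuousLinearMap.le_of_opNorm_le _ (hLip _ _) v).trans (le_of_eq ?_)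
      rw [add_sub_cancel_left, norm_smul, Real.norm_of_nonneg ht.1]
      ring)
    (Set.right_mem_Icc.2 zero_le_one)
  simpa [hv] using key

section Coercive

variable {E : Type*} [NormedAddCommGroup E] [InnerProductSpace ℝ E]

theorem ContinuousLinearMap.mul_norm_le_of_coercive {A : E →L[ℝ] E} {c : ℝ}
    (hA : ∀ h : E, c * ‖h‖ ^ 2 ≤ ⟪h, A h⟫) (h : E) : c * ‖h‖ ≤ ‖A h‖ := by
  rcases (norm_nonneg h).eq_or_lt with h0 | h0
  · simp [← h0]
  · refine le_of_mul_le_mul_left ?_ h0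
    linarith [hA h, real_inner_le_norm h (A h)]

theorem ContinuousLinearMap.coercive_of_norm_sub_le {A B : E →L[ℝ] E} {c δ : ℝ}
    (hA : ∀ h : E, c * ‖h‖ ^ 2 ≤ ⟪h, A h⟫) (hAB : ‖B - A‖ ≤ δ) (h : E) :
    (c - δ) * ‖h‖ ^ 2 ≤ ⟪h, B h⟫ := by
  have hsub : |⟪h, (B - A) h⟫| ≤ δ * ‖h‖ ^ 2 := by
    calc |⟪h, (B - A) h⟫| ≤ ‖h‖ * ‖(B - A) h‖ := abs_real_inner_le_norm _ _
      _ ≤ ‖h‖ * (δ * ‖h‖) := by gcongr; exact ContinuousLinearMap.le_of_opNorm_le _ hAB h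
      _ = δ * ‖h‖ ^ 2 := by ring
  rw [sub_apply, inner_sub_right] at hsub
  linarith [hA h, neg_le_of_abs_le hsub]

theorem ContinuousLinearMap.isUnit_of_coercive [FiniteDimensional ℝ E] {A : E →L[ℝ] E} {c : ℝ}
    (hc : 0 < c) (hA : ∀ h : E, c * ‖h‖ ^ 2 ≤ ⟪h, A h⟫) : IsUnit A := by
  have := FiniteDimensional.complete ℝ E
  have hinj : Function.Injective A := by
    refine (injective_iff_map_eq_zero A).2 fun h hh => ?_
    have := A.mul_norm_le_of_coercive hA h
    rw [hh, norm_zero] at this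
    exact norm_le_zero_iff.1 (by nlinarith)
  exact ContinuousLinearMap.isUnit_iff_bijective.2
    ⟨hinj, LinearMap.injective_iff_surjective (f := (A : E →ₗ[ℝ] E)).1 hinj⟩

theorem ContinuousLinearMap.apply_inverse_of_isUnit {A : E →L[ℝ] E} (hA : IsUnit A) (w : E) :
    A (A.inverse w) = w := by
  rw [← ContinuousLinearMap.ringInverse_eq_inverse]
  exact DFunLike.congr_fun (Ring.mul_inverse_cancel A hA) w

end Coercive

/-- Quadratic local convergence of Newton's method. The Hessian of `f` at `x` is the
continuous linear map `fderiv ℝ (gradient f) x`, and `‖·‖` on Hessians is the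
operator norm. -/
theorem stmt_19 (n : ℕ) (f : EuclideanSpace ℝ (Fin n) → ℝ)
    (hdiff : Differentiable ℝ f)
    (hdiff2 : Differentiable ℝ (gradient f))
    (M : ℝ) (hM : 0 < M)
    (hLip : ∀ x y : EuclideanSpace ℝ (Fin n),
      ‖fderiv ℝ (gradient f) x - fderiv ℝ (gradient f) y‖ ≤ M * ‖x - y‖)
    (xstar : EuclideanSpace ℝ (Fin n))
    (hgrad0 : gradient f xstar = 0)
    (μ : ℝ) (hμ : 0 < μ)
    (hpos : ∀ h : EuclideanSpace ℝ (Fin n),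
      μ * ‖h‖ ^ 2 ≤ ⟪h, fderiv ℝ (gradient f) xstar h⟫)
    (x : ℕ → EuclideanSpace ℝ (Fin n))
    (hx0 : ‖x 0 - xstar‖ ≤ μ / (2 * M))
    (hiter : ∀ k : ℕ, IsUnit (fderiv ℝ (gradient f) (x k)) →
      x (k + 1) = x k - (fderiv ℝ (gradient f) (x k)).inverse (gradient f (x k))) :
    ∀ k : ℕ,
      IsUnit (fderiv ℝ (gradient f) (x k)) ∧
      ‖x k - xstar‖ ≤ μ / (2 * M) ∧
      ‖x (k + 1) - xstar‖ ≤ M / μ * ‖x k - xstar‖ ^ 2 := by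
  have step : ∀ k, ‖x k - xstar‖ ≤ μ / (2 * M) →
      IsUnit (fderiv ℝ (gradient f) (x k)) ∧
      ‖x (k + 1) - xstar‖ ≤ M / μ * ‖x k - xstar‖ ^ 2 := by
    intro k hk
    set A := fderiv ℝ (gradient f) (x k) with hA
    have hMk : M * ‖x k - xstar‖ ≤ μ / 2 := by
      calc M * ‖x k - xstar‖ ≤ M * (μ / (2 * M)) := by gcongr
        _ = μ / 2 := by field_simp
    have hcoer := ContinuousLinearMap.coercive_of_norm_sub_le hpos
      ((hLip (x k) xstar).trans hMk)
    have hunit : IsUnit A := ContinuousLinearMap.isUnit_of_coercive (by linarith) hcoer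
    refine ⟨hunit, ?_⟩
    have htaylor := norm_sub_sub_fderiv_le_of_lipschitz hdiff2 hLip (x k) xstar
    have herr : A (x (k + 1) - xstar) =
        gradient f xstar - gradient f (x k) - A (xstar - x k) := by
      rw [hiter k hunit, hgrad0, ← hA]
      simp only [map_sub, ContinuousLinearMap.apply_inverse_of_isUnit hunit]
      abel
    have hlow := A.mul_norm_le_of_coercive hcoer (x (k + 1) - xstar)
    rw [herr] at hlow
    rw [norm_sub_rev xstar] at htaylor
    rw [div_mul_eq_mul_div, le_div_iff₀ hμ]
    linarith
  have hball : ∀ k, ‖x k - xstar‖ ≤ μ / (2 * M) := by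
    intro k
    induction k with
    | zero => exact hx0
    | succ k ih =>
      calc ‖x (k + 1) - xstar‖ ≤ M / μ * ‖x k - xstar‖ ^ 2 := (step k ih).2
        _ ≤ M / μ * (μ / (2 * M)) ^ 2 := by gcongr
        _ = μ / (2 * M) / 2 := by field_simp
        _ ≤ μ / (2 * M) := half_le_self (by positivity)
  exact fun k => ⟨(step k (hball k)).1, hball k, (step k (hball k)).2⟩
end
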